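/- Suppose Φ is continuously differentiable with partial derivatives ∂ᵢΦ. Let δ ∈ (0,2), β² = 8δ/(2+δ)², c_β = 1 − Real.sqrt (1 − β²). Define ν_L as the pushforward of μ1.prod η under (u, ξ) ↦ (u, fun i => Real.sqrt (1 − β²) · u i − c_β · σ i · ∂ᵢΦ(u) + β · Real.sqrt (σ i) · ξ i), and ν_L^⊥ = Measure.map Prod.swap ν_L. Then ν_L^⊥ and ν_L are equivalent, and for ν_L-almost every (u,v), (dν_L^⊥/dν_L)(u,v) = Real.exp (𝒥(u,v)) where 𝒥(u,v) = Φ(u) − Φ(v) + (δ/4)·∑ᵢ σ i·((∂ᵢΦ(u))² − (∂ᵢΦ(v))²) + (1/2)·∑ᵢ (v i − u i)·(∂ᵢΦ(u) + ∂ᵢΦ(v)) + (δ/4)·∑ᵢ (v i + u i)·(∂ᵢΦ(u) − ∂ᵢΦ(v)). (This is the preconditioned Crank–Nicolson Langevin Metropolis–Hastings acceptance ratio.) -/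

import Mathlib

open MeasureTheory ProbabilityTheory

/-- A product of nondegenerate Gaussian measures has the product of the Gaussian densities as
density with respect to Lebesgue measure. -/
lemma pi_gaussianReal_eq_withDensity {ι : Type*} [Fintype ι] (m : ι → ℝ) (v : ι → NNReal)
    (hv : ∀ i, v i ≠ 0) :
    Measure.pi (fun i => gaussianReal (m i) (v i)) =
      (volume : Measure (ι → ℝ)).withDensity
        (fun x => ENNReal.ofReal (∏ i, gaussianPDFReal (m i) (v i) (x i))) := by
  refine Measure.pi_eq fun s hs => ?_
  rw [withDensity_apply _ (MeasurableSet.univ_pi hs), volume_pi, Measure.restrict_pi_pi,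
    ← ofReal_integral_eq_lintegral_ofReal
      (Integrable.fintype_prod fun i => (integrable_gaussianPDFReal (m i) (v i)).restrict)
      (ae_of_all _ fun x => Finset.prod_nonneg fun i _ => gaussianPDFReal_nonneg _ _ _),
    integral_fintype_prod_eq_prod (fun i x => gaussianPDFReal (m i) (v i) x),
    ENNReal.ofReal_prod_of_nonneg
      fun i _ => integral_nonneg fun x => gaussianPDFReal_nonneg _ _ _]
  exact Finset.prod_congr rfl fun i _ => (gaussianReal_apply_eq_integral _ (hv i) _).symm

/-- The image of a standard Gaussian vector under a coordinatewise affine map. -/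
lemma map_pi_gaussianReal_affine {ι : Type*} [Fintype ι] (m c : ι → ℝ) :
    (Measure.pi (fun _ : ι => gaussianReal 0 1)).map (fun x i => m i + c i * x i) =
      Measure.pi (fun i => gaussianReal (m i) (c i ^ 2).toNNReal) := by
  have h (i : ι) : (gaussianReal 0 1).map (fun x => m i + c i * x) =
      gaussianReal (m i) (c i ^ 2).toNNReal := by
    rw [show (fun x => m i + c i * x) = (fun x => m i + x) ∘ (fun x => c i * x) from rfl,
      ← Measure.map_map (by fun_prop) (by fun_prop), gaussianReal_map_const_mul,
      gaussianReal_map_const_add]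
    congr 1
    · ring
    · rw [mul_one]
      exact (Real.toNNReal_of_nonneg (sq_nonneg _)).symm
  have (i : ι) : SigmaFinite ((gaussianReal 0 1).map (fun x => m i + c i * x)) := by
    rw [h i]; infer_instance
  rw [Measure.pi_map_pi (f := fun i x => m i + c i * x) (fun i => by fun_prop)]
  simp_rw [h]

lemma prod_gaussianPDFReal {ι : Type*} [Fintype ι] (m : ι → ℝ) (v : ι → NNReal) (x : ι → ℝ) :
    ∏ i, gaussianPDFReal (m i) (v i) (x i) =
      (∏ i, (Real.sqrt (2 * Real.pi * v i))⁻¹) *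
        Real.exp (∑ i, -(x i - m i) ^ 2 / (2 * v i)) := by
  simp only [gaussianPDFReal, Finset.prod_mul_distrib, Real.exp_sum]

/-- If `T u` maps `η` to a measure with density `g u` with respect to `ρ`, then
`(u, ξ) ↦ (u, T u ξ)` maps `f μ ⊗ η` to a measure with density `f u * g u v` with respect to
`μ ⊗ ρ`. -/
lemma map_prodMk_prod_eq_withDensity {α β γ : Type*} [MeasurableSpace α] [MeasurableSpace β]
    [MeasurableSpace γ] {μ : Measure α} {η : Measure β} {ρ : Measure γ} [SFinite μ] [SFinite η]
    [SFinite ρ] {f : α → ENNReal} (hf : Measurable f) {T : α → β → γ}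
    (hT : Measurable (Function.uncurry T)) {g : α → γ → ENNReal}
    (hg : Measurable (Function.uncurry g)) (h : ∀ u, η.map (T u) = ρ.withDensity (g u)) :
    ((μ.withDensity f).prod η).map (fun p => (p.1, T p.1 p.2)) =
      (μ.prod ρ).withDensity (fun p => f p.1 * g p.1 p.2) := by
  have hg' : Measurable fun p : α × γ => g p.1 p.2 := hg
  have hT' : Measurable fun p : α × β => T p.1 p.2 := hT
  refine Measure.ext_of_lintegral _ fun φ hφ => ?_
  rw [lintegral_map hφ (by fun_prop), lintegral_prod _ (by fun_prop),
    lintegral_withDensity_eq_lintegral_mul _ hf (by fun_prop),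
    lintegral_withDensity_eq_lintegral_mul _ (by fun_prop) hφ, lintegral_prod _ (by fun_prop)]
  refine lintegral_congr fun u => ?_
  have hgu : Measurable (g u) := hg'.comp measurable_prodMk_left
  have hTu : Measurable (T u) := hT'.comp measurable_prodMk_left
  have hφu : Measurable fun y => φ (u, y) := hφ.comp measurable_prodMk_left
  simp only [Pi.mul_apply, mul_assoc]
  rw [lintegral_const_mul (f := fun y => g u y * φ (u, y)) _ (hgu.mul hφu),
    ← lintegral_map hφu hTu, h u,
    lintegral_withDensity_eq_lintegral_mul _ hgu hφu]
  rfl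

lemma map_swap_withDensity {α : Type*} [MeasurableSpace α] {ρ : Measure α} [SFinite ρ]
    {F : α × α → ENNReal} (hF : Measurable F) :
    ((ρ.prod ρ).withDensity F).map Prod.swap = (ρ.prod ρ).withDensity (F ∘ Prod.swap) := by
  refine Measure.ext_of_lintegral _ fun φ hφ => ?_
  rw [lintegral_map hφ measurable_swap,
    lintegral_withDensity_eq_lintegral_mul _ hF (g := fun p => φ p.swap)
      (hφ.comp measurable_swap),
    lintegral_withDensity_eq_lintegral_mul _ (hF.comp measurable_swap) hφ,
    ← lintegral_prod_swap]
  rfl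

/-- The preconditioned Crank–Nicolson Langevin Metropolis–Hastings acceptance ratio:
with target `μ1 = exp(−Φ) dμ0`, prior `μ0 = N(0, σ)`, step size `δ ∈ (0,2)`,
`β² = 8δ/(2+δ)²` and `c_β = 1 − √(1 − β²)`, letting `ν_L` denote the pCNL joint law of
`(u, v)` and `ν_L^⊥` its swap, `ν_L^⊥` and `ν_L` are equivalent and
`(dν_L^⊥/dν_L)(u,v) = exp(𝒥(u,v))` where
`𝒥(u,v) = Φ(u) − Φ(v) + (δ/4)∑σᵢ((∂ᵢΦ(u))² − (∂ᵢΦ(v))²)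
  + (1/2)∑(vᵢ−uᵢ)(∂ᵢΦ(u)+∂ᵢΦ(v)) + (δ/4)∑(vᵢ+uᵢ)(∂ᵢΦ(u)−∂ᵢΦ(v))`. -/
theorem pCNL_metropolis_hastings_ratio
    (n : ℕ) (σ : Fin n → ℝ) (hσ : ∀ i, 0 < σ i)
    (Φ : (Fin n → ℝ) → ℝ) (hC1 : ContDiff ℝ 1 Φ)
    (hnorm : ∫ u, Real.exp (-Φ u)
      ∂(Measure.pi (fun i => gaussianReal 0 (σ i).toNNReal)) = 1)
    (μ1 : Measure (Fin n → ℝ))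
    (hμ1 : μ1 = (Measure.pi (fun i => gaussianReal 0 (σ i).toNNReal)).withDensity
      (fun u => ENNReal.ofReal (Real.exp (-Φ u))))
    (δ : ℝ) (hδ : δ ∈ Set.Ioo (0 : ℝ) 2)
    (β : ℝ) (hβ0 : 0 ≤ β) (hβ2 : β ^ 2 = 8 * δ / (2 + δ) ^ 2)
    (νL : Measure ((Fin n → ℝ) × (Fin n → ℝ)))
    (hνL : νL = Measure.map
      (fun p : (Fin n → ℝ) × (Fin n → ℝ) =>
        (p.1, fun i => Real.sqrt (1 - β ^ 2) * p.1 i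
          - (1 - Real.sqrt (1 - β ^ 2)) * σ i * fderiv ℝ Φ p.1 (Pi.single i 1)
          + β * Real.sqrt (σ i) * p.2 i))
      (μ1.prod (Measure.pi (fun _ : Fin n => gaussianReal 0 1)))) :
    (Measure.map Prod.swap νL ≪ νL ∧ νL ≪ Measure.map Prod.swap νL) ∧
      ∀ᵐ p ∂νL, (Measure.map Prod.swap νL).rnDeriv νL p
        = ENNReal.ofReal (Real.exp (Φ p.1 - Φ p.2
            + (δ / 4) * ∑ i, σ i * ((fderiv ℝ Φ p.1 (Pi.single i 1)) ^ 2
                - (fderiv ℝ Φ p.2 (Pi.single i 1)) ^ 2)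
            + (1 / 2) * ∑ i, (p.2 i - p.1 i)
                * (fderiv ℝ Φ p.1 (Pi.single i 1) + fderiv ℝ Φ p.2 (Pi.single i 1))
            + (δ / 4) * ∑ i, (p.2 i + p.1 i)
                * (fderiv ℝ Φ p.1 (Pi.single i 1) - fderiv ℝ Φ p.2 (Pi.single i 1)))) := by
  obtain ⟨hδ0, hδ2⟩ := hδ
  have hβpos : 0 < β := by
    refine lt_of_le_of_ne hβ0 fun h => ?_
    rw [← h] at hβ2
    have : 0 < 8 * δ / (2 + δ) ^ 2 := by positivity
    simp [← hβ2] at this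
  have hsqrt : Real.sqrt (1 - β ^ 2) = (2 - δ) / (2 + δ) := by
    rw [show 1 - β ^ 2 = ((2 - δ) / (2 + δ)) ^ 2 by rw [hβ2]; field_simp; ring]
    exact Real.sqrt_sq (div_nonneg (by linarith) (by linarith))
  rw [hsqrt] at hνL
  set g : (Fin n → ℝ) → Fin n → ℝ := fun u i => fderiv ℝ Φ u (Pi.single i 1)
  have hgm (i : Fin n) : Measurable fun u => g u i :=
    ((hC1.continuous_fderiv one_ne_zero).clm_apply continuous_const).measurable
  have hΦm : Measurable Φ := hC1.continuous.measurable
  set m : (Fin n → ℝ) → Fin n → ℝ := fun u i =>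
    (2 - δ) / (2 + δ) * u i - (1 - (2 - δ) / (2 + δ)) * σ i * g u i with hm
  have hmm (i : Fin n) : Measurable fun u => m u i := by fun_prop
  have hvar (i : Fin n) : (β * Real.sqrt (σ i)) ^ 2 = 8 * δ / (2 + δ) ^ 2 * σ i := by
    rw [mul_pow, Real.sq_sqrt (hσ i).le, hβ2]
  have hvarpos (i : Fin n) : 0 < 8 * δ / (2 + δ) ^ 2 * σ i := by have := hσ i; positivity
  set C₀ : ℝ := ∏ i, (Real.sqrt (2 * Real.pi * (σ i).toNNReal))⁻¹
  set C₁ : ℝ := ∏ i, (Real.sqrt (2 * Real.pi * ((β * Real.sqrt (σ i)) ^ 2).toNNReal))⁻¹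
  set f : (Fin n → ℝ) → ENNReal := fun u =>
    ENNReal.ofReal (C₀ * Real.exp (∑ i, -(u i) ^ 2 / (2 * σ i))) *
      ENNReal.ofReal (Real.exp (-Φ u)) with hf
  set q : (Fin n → ℝ) → (Fin n → ℝ) → ENNReal := fun u v => ENNReal.ofReal
    (C₁ * Real.exp (∑ i, -(v i - m u i) ^ 2 / (2 * (8 * δ / (2 + δ) ^ 2 * σ i)))) with hq
  have hfm : Measurable f := by fun_prop
  have hqm : Measurable (Function.uncurry q) := by
    unfold Function.uncurry
    fun_prop
  have hμ1f : μ1 = volume.withDensity f := by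
    rw [hμ1, pi_gaussianReal_eq_withDensity _ _ fun i => (Real.toNNReal_pos.2 (hσ i)).ne',
      ← withDensity_mul _ (by fun_prop) (by fun_prop)]
    congr 1
    funext u
    simp only [hf, Pi.mul_apply, prod_gaussianPDFReal, sub_zero,
      fun i => Real.coe_toNNReal _ (hσ i).le, C₀]
  have hνF : νL = ((volume : Measure (Fin n → ℝ)).prod volume).withDensity
      (fun p => f p.1 * q p.1 p.2) := by
    rw [hνL, hμ1f]
    refine map_prodMk_prod_eq_withDensity hfm
      (T := fun u (x : Fin n → ℝ) i => m u i + β * Real.sqrt (σ i) * x i)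
      (by unfold Function.uncurry; fun_prop) hqm fun u => ?_
    rw [map_pi_gaussianReal_affine, pi_gaussianReal_eq_withDensity]
    · congr 1
      funext v
      simp only [hq, prod_gaussianPDFReal, C₁, hvar,
        fun i => Real.coe_toNNReal _ (hvarpos i).le]
    · exact fun i => (Real.toNNReal_pos.2 (by rw [hvar]; exact hvarpos i)).ne'
  set J : (Fin n → ℝ) × (Fin n → ℝ) → ℝ := fun p => Φ p.1 - Φ p.2
    + (δ / 4) * ∑ i, σ i * ((g p.1 i) ^ 2 - (g p.2 i) ^ 2)
    + (1 / 2) * ∑ i, (p.2 i - p.1 i) * (g p.1 i + g p.2 i)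
    + (δ / 4) * ∑ i, (p.2 i + p.1 i) * (g p.1 i - g p.2 i) with hJ
  have hJm : Measurable J := by fun_prop
  set K : (Fin n → ℝ) × (Fin n → ℝ) → ENNReal := fun p => ENNReal.ofReal (Real.exp (J p))
  have hKm : Measurable K := by fun_prop
  have hFm : Measurable fun p : (Fin n → ℝ) × (Fin n → ℝ) => f p.1 * q p.1 p.2 := by
    have : Measurable fun p : (Fin n → ℝ) × (Fin n → ℝ) => q p.1 p.2 := hqm
    fun_prop
  have hC₀ : 0 ≤ C₀ := by positivity
  have hC₁ : 0 ≤ C₁ := by positivity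
  have hbalance (u v : Fin n → ℝ) : f v * q v u = f u * q u v * K (u, v) := by
    simp only [hf, hq, K]
    rw [← ENNReal.ofReal_mul (by positivity), ← ENNReal.ofReal_mul (by positivity),
      ← ENNReal.ofReal_mul (by positivity), ← ENNReal.ofReal_mul (by positivity),
      ← ENNReal.ofReal_mul (by positivity)]
    congr 1
    have hexp : ∑ i, -(v i) ^ 2 / (2 * σ i) + -Φ v +
          ∑ i, -(u i - m v i) ^ 2 / (2 * (8 * δ / (2 + δ) ^ 2 * σ i)) =
        ∑ i, -(u i) ^ 2 / (2 * σ i) + -Φ u +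
          ∑ i, -(v i - m u i) ^ 2 / (2 * (8 * δ / (2 + δ) ^ 2 * σ i)) + J (u, v) := by
      have hsum : ∑ i, (-(v i) ^ 2 / (2 * σ i) +
            -(u i - m v i) ^ 2 / (2 * (8 * δ / (2 + δ) ^ 2 * σ i))) =
          ∑ i, (-(u i) ^ 2 / (2 * σ i) +
            -(v i - m u i) ^ 2 / (2 * (8 * δ / (2 + δ) ^ 2 * σ i)) +
            (δ / 4) * (σ i * ((g u i) ^ 2 - (g v i) ^ 2)) +
            (1 / 2) * ((v i - u i) * (g u i + g v i)) +
            (δ / 4) * ((v i + u i) * (g u i - g v i))) := by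
        refine Finset.sum_congr rfl fun i _ => ?_
        have := (hσ i).ne'
        simp only [hm]
        generalize g u i = a
        generalize g v i = b
        field_simp
        ring
      simp only [Finset.sum_add_distrib, ← Finset.mul_sum] at hsum
      simp only [hJ]
      linarith
    have hexp' := congrArg Real.exp hexp
    simp only [Real.exp_add] at hexp'
    linear_combination C₀ * C₁ * hexp'
  have hswap : Measure.map Prod.swap νL = νL.withDensity K := by
    rw [hνF, map_swap_withDensity hFm, ← withDensity_mul _ hFm hKm]
    congr 1
    funext p
    exact hbalance p.1 p.2
  have : IsProbabilityMeasure μ1 := by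
    refine ⟨?_⟩
    rw [hμ1, withDensity_apply _ MeasurableSet.univ, Measure.restrict_univ,
      ← ofReal_integral_eq_lintegral_ofReal _ (ae_of_all _ fun u => (Real.exp_pos _).le), hnorm,
      ENNReal.ofReal_one]
    by_contra h
    simp [integral_undef h] at hnorm
  have : IsFiniteMeasure νL := by rw [hνL]; infer_instance
  rw [hswap]
  refine ⟨⟨withDensity_absolutelyContinuous _ _, withDensity_absolutelyContinuous'
    hKm.aemeasurable (ae_of_all _ fun p => ?_)⟩, Measure.rnDeriv_withDensity νL hKm⟩
  exact (ENNReal.ofReal_pos.2 (Real.exp_pos _)).ne'
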